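/- Let ψ₀ be a constant element of the even subalgebra of ℝ_{1,3}, let β, S : ℝ⁴ → ℝ be differentiable functions, and define ψ(x) = (cos(β(x)/2) + sin(β(x)/2) γ5) · ψ₀ · e^{S(x)γ21} (a spinor field with Takabayashi angle β). Then for every x ∈ ℝ⁴: Σ_μ γ^μ (∂_μ ψ)(x) γ21 = −(Σ_μ γ^μ ∂_μ S(x)) ψ(x) − ½ γ5 (Σ_μ γ^μ ∂_μ β(x)) ψ(x) γ21. -/

import Mathlib

noncomputable section
open CliffordAlgebra

/-- The Minkowski quadratic form `Q(x) = x₀² - x₁² - x₂² - x₃²` on `ℝ⁴`. -/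
def Qmink : QuadraticForm ℝ (Fin 4 → ℝ) :=
  QuadraticMap.weightedSumSquares ℝ ![(1 : ℝ), -1, -1, -1]

/-- The spacetime algebra `ℝ_{1,3}`. -/
abbrev STA : Type := CliffordAlgebra Qmink

/-- The generating vectors `γ_μ = ι(e_μ)`. -/
def γ (μ : Fin 4) : STA := ι Qmink (Pi.single μ 1)

/-- The signs `η^{μμ} = diag(1,-1,-1,-1)`. -/
def ηsgn (μ : Fin 4) : ℝ := if μ = 0 then 1 else -1

/-- The raised-index vectors `γ^μ := η^{μμ} γ_μ`. -/
def γup (μ : Fin 4) : STA := ηsgn μ • γ μ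

/-- The bivector `γ21 := γ₂γ₁` (it squares to `-1`). -/
def γ21 : STA := γ 2 * γ 1

/-- `e^{θ γ21} := cos θ + (sin θ) γ21`. -/
def expG21 (θ : ℝ) : STA := algebraMap ℝ STA (Real.cos θ) + Real.sin θ • γ21

/-- The partial derivative `∂_μ f` of a function `f : ℝ⁴ → ℝ` at `x`. -/
def pd (μ : Fin 4) (f : (Fin 4 → ℝ) → ℝ) (x : Fin 4 → ℝ) : ℝ :=
  deriv (fun t : ℝ => f (x + t • (Pi.single μ 1 : Fin 4 → ℝ))) 0

/-- `f' ` is the `μ`-th partial derivative of the spacetime-algebra valued field `f`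
(tested against all real-linear functionals, since `STA` carries no topology). -/
def HasPDeriv (μ : Fin 4) (f f' : (Fin 4 → ℝ) → STA) : Prop :=
  ∀ (L : STA →ₗ[ℝ] ℝ) (x : Fin 4 → ℝ),
    HasDerivAt (fun t : ℝ => L (f (x + t • (Pi.single μ 1 : Fin 4 → ℝ)))) (L (f' x)) 0

/-- The pseudoscalar `γ5 := γ₀γ₁γ₂γ₃`. -/
def γ5 : STA := γ 0 * γ 1 * γ 2 * γ 3

theorem γ_mul_self (μ : Fin 4) : γ μ * γ μ = algebraMap ℝ STA (ηsgn μ) := by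
  rw [γ, ι_sq_scalar]
  congr 1
  fin_cases μ <;> simp [Qmink, ηsgn, QuadraticMap.weightedSumSquares_apply, Fin.sum_univ_four]

theorem γ_anticomm {μ ν : Fin 4} (h : μ ≠ ν) : γ μ * γ ν = -(γ ν * γ μ) := by
  refine ι_mul_ι_comm_of_isOrtho ?_
  rw [QuadraticMap.isOrtho_def]
  fin_cases μ <;> fin_cases ν <;>
    simp_all [Qmink, QuadraticMap.weightedSumSquares_apply, Fin.sum_univ_four]

theorem γ_anticomm_assoc {μ ν : Fin 4} (h : μ ≠ ν) (a : STA) :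
    γ μ * (γ ν * a) = -(γ ν * (γ μ * a)) := by
  rw [← mul_assoc, γ_anticomm h, neg_mul, mul_assoc]

theorem γ_mul_self_assoc (μ : Fin 4) (a : STA) : γ μ * (γ μ * a) = ηsgn μ • a := by
  rw [← mul_assoc, γ_mul_self, Algebra.smul_def]

theorem γ21_mul_self : γ21 * γ21 = -1 := by
  have h : γ 1 * (γ 2 * γ 1) = -(γ 2 * (γ 1 * γ 1)) := γ_anticomm_assoc (by decide) _
  rw [γ21, mul_assoc, h, mul_neg, γ_mul_self_assoc, γ_mul_self]
  simp [ηsgn]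

theorem γ_mul_γ5 (μ : Fin 4) : γ μ * γ5 = -(γ5 * γ μ) := by
  have h30 := γ_anticomm (show (3 : Fin 4) ≠ 0 by decide)
  have h31 := γ_anticomm (show (3 : Fin 4) ≠ 1 by decide)
  have h32 := γ_anticomm (show (3 : Fin 4) ≠ 2 by decide)
  have k10 := γ_anticomm_assoc (show (1 : Fin 4) ≠ 0 by decide)
  have k20 := γ_anticomm_assoc (show (2 : Fin 4) ≠ 0 by decide)
  have k30 := γ_anticomm_assoc (show (3 : Fin 4) ≠ 0 by decide)
  have k21 := γ_anticomm_assoc (show (2 : Fin 4) ≠ 1 by decide)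
  have k31 := γ_anticomm_assoc (show (3 : Fin 4) ≠ 1 by decide)
  have k32 := γ_anticomm_assoc (show (3 : Fin 4) ≠ 2 by decide)
  fin_cases μ <;>
    simp [γ5, mul_assoc, h30, h31, h32, k10, k20, k30, k21, k31, k32,
      γ_mul_self, γ_mul_self_assoc, ηsgn]

theorem γ5_mul_self : γ5 * γ5 = -1 := by
  have h : γ5 * γ5 = γ 0 * (γ 1 * (γ 2 * (γ 3 * γ5))) := by
    simp only [γ5, mul_assoc]
  rw [h, γ_mul_γ5]
  have k : γ5 = γ 0 * (γ 1 * (γ 2 * γ 3)) := by simp only [γ5, mul_assoc]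
  have k10 := γ_anticomm_assoc (show (1 : Fin 4) ≠ 0 by decide)
  have k20 := γ_anticomm_assoc (show (2 : Fin 4) ≠ 0 by decide)
  have k21 := γ_anticomm_assoc (show (2 : Fin 4) ≠ 1 by decide)
  simp [k, mul_assoc, k10, k20, k21, γ_mul_self, ηsgn]

/-- `STA` carries no topology: elements are identified through their linear functionals. -/
theorem eq_of_forall_linearMap {a b : STA} (h : ∀ L : STA →ₗ[ℝ] ℝ, L a = L b) : a = b :=
  (Module.forall_dual_apply_eq_zero_iff ℝ (a - b)).1 (fun L => by rw [map_sub, h, sub_self])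
    |> sub_eq_zero.1

theorem hasDerivAt_pd {f : (Fin 4 → ℝ) → ℝ} (hf : Differentiable ℝ f) (μ : Fin 4)
    (x : Fin 4 → ℝ) :
    HasDerivAt (fun t : ℝ => f (x + t • (Pi.single μ 1 : Fin 4 → ℝ))) (pd μ f x) 0 := by
  refine DifferentiableAt.hasDerivAt ?_
  fun_prop

theorem hasPDeriv_spinor (ψ₀ : STA) {β S : (Fin 4 → ℝ) → ℝ} (hβ : Differentiable ℝ β)
    (hS : Differentiable ℝ S) {ψ : (Fin 4 → ℝ) → STA}
    (hψ : ψ = fun x =>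
      (algebraMap ℝ STA (Real.cos (β x / 2)) + Real.sin (β x / 2) • γ5) * ψ₀
        * expG21 (S x)) (μ : Fin 4) :
    HasPDeriv μ ψ fun x => (pd μ β x / 2) • (γ5 * ψ x) + pd μ S x • (ψ x * γ21) := by
  intro L x
  have hb := (hasDerivAt_pd hβ μ x).div_const 2
  have hs := hasDerivAt_pd hS μ x
  have expand (b s : ℝ) :
      (algebraMap ℝ STA (Real.cos b) + Real.sin b • γ5) * ψ₀ * expG21 s
        = (Real.cos b * Real.cos s) • ψ₀ + (Real.cos b * Real.sin s) • (ψ₀ * γ21)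
          + (Real.sin b * Real.cos s) • (γ5 * ψ₀)
          + (Real.sin b * Real.sin s) • (γ5 * ψ₀ * γ21) := by
    simp only [expG21, Algebra.algebraMap_eq_smul_one, add_mul, mul_add, smul_mul_assoc,
      mul_smul_comm, one_mul, mul_one, mul_assoc]
    module
  have left (a : STA) : γ5 * (γ5 * a) = -a := by rw [← mul_assoc, γ5_mul_self, neg_one_mul]
  simp only [hψ, expand]
  simp only [map_add, map_smul, smul_eq_mul, mul_add, add_mul, mul_smul_comm,
    smul_mul_assoc, mul_assoc, left, γ21_mul_self, mul_neg, mul_one, map_neg]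
  have h := ((((hb.cos.mul hs.cos).mul_const (L ψ₀)).add
    ((hb.cos.mul hs.sin).mul_const (L (ψ₀ * γ21)))).add
    ((hb.sin.mul hs.cos).mul_const (L (γ5 * ψ₀)))).add
    ((hb.sin.mul hs.sin).mul_const (L (γ5 * (ψ₀ * γ21))))
  simp only [zero_smul, add_zero] at h
  refine (h.congr_deriv ?_).congr_of_eventuallyEq (.of_forall fun t => ?_)
  · ring
  · simp only [Pi.add_apply, Pi.mul_apply]
    ring

/-- For a spinor field `ψ(x) = e^{β(x)γ5/2} ψ₀ e^{S(x)γ21}` with Takabayashi angle `β` and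
`ψ₀` a constant even element:
`∂ψ γ21 = -(∂S) ψ - ½ γ5 (∂β) ψ γ21`. -/
theorem statement9 (ψ₀ : STA) (hψ₀ : ψ₀ ∈ evenOdd Qmink 0)
    (β S : (Fin 4 → ℝ) → ℝ) (hβ : Differentiable ℝ β) (hS : Differentiable ℝ S)
    (ψ : (Fin 4 → ℝ) → STA)
    (hψ : ψ = fun x =>
      (algebraMap ℝ STA (Real.cos (β x / 2)) + Real.sin (β x / 2) • γ5) * ψ₀
        * expG21 (S x))
    (ψ' : Fin 4 → (Fin 4 → ℝ) → STA) (hψ' : ∀ μ, HasPDeriv μ ψ (ψ' μ))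
    (x : Fin 4 → ℝ) :
    ∑ μ, γup μ * ψ' μ x * γ21
      = -((∑ μ, pd μ S x • γup μ) * ψ x)
        - (2 : ℝ)⁻¹ • (γ5 * (∑ μ, pd μ β x • γup μ) * ψ x * γ21) := by
  have hd (μ : Fin 4) :
      ψ' μ x = (pd μ β x / 2) • (γ5 * ψ x) + pd μ S x • (ψ x * γ21) :=
    eq_of_forall_linearMap fun L =>
      (hψ' μ L x).unique (hasPDeriv_spinor ψ₀ hβ hS hψ μ L x)
  have hγ5 (μ : Fin 4) : γup μ * (γ5 * ψ x) = -(γ5 * (γup μ * ψ x)) := by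
    rw [← mul_assoc, γup, smul_mul_assoc, γ_mul_γ5]
    simp only [smul_neg, neg_mul, smul_mul_assoc, mul_smul_comm, mul_assoc]
  simp only [Finset.sum_mul, Finset.mul_sum, Finset.smul_sum]
  rw [← Finset.sum_neg_distrib, ← Finset.sum_sub_distrib]
  refine Finset.sum_congr rfl fun μ _ => ?_
  rw [hd]
  simp only [mul_add, add_mul, mul_smul_comm, smul_mul_assoc, hγ5]
  simp only [mul_assoc, γ21_mul_self, neg_mul, mul_neg, mul_one]
  module
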